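/- arXiv:math/0210427 — 4 statements merged into one kernel-verified Lean document; each statement's English description precedes it below -/
import Mathlib

section
/- Assume: (i) ℛ₁(u,v) · ℛ₂(u,v) = v · u for all u, v ∈ G (i.e. m ∘ ℛ = m ∘ flip); (ii) ℛ(u·v, w) = (ℛ₁(u,w) · ℛ₁(v, ℛ₂(u,w)), ℛ₂(v, ℛ₂(u,w))) for all u, v, w ∈ G (i.e. ℛ ∘ (m × id) = (m × id) ∘ ℛ₂₃ ∘ ℛ₁₃); and (iii) ℛ(u, v·w) = (ℛ₁(ℛ₁(u,w), v), ℛ₂(ℛ₁(u,w), v) · ℛ₂(u,w)) for all u, v, w ∈ G (i.e. ℛ ∘ (id × m) = (id × m) ∘ ℛ₁₂ ∘ ℛ₁₃). Then ℛ satisfies the set-theoretic quantum Yang–Baxter equation: ℛ₁₂ ∘ ℛ₁₃ ∘ ℛ₂₃ = ℛ₂₃ ∘ ℛ₁₃ ∘ ℛ₁₂ as maps G × G × G → G × G × G. -/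
variable {G : Type*} [Group G]

/-- `ℛ₁₂ : G × G × G → G × G × G`, acting by `ℛ` on the first two factors. -/
def R12 (ℛ : G × G → G × G) : G × G × G → G × G × G :=
  fun p => ((ℛ (p.1, p.2.1)).1, (ℛ (p.1, p.2.1)).2, p.2.2)

/-- `ℛ₂₃ : G × G × G → G × G × G`, acting by `ℛ` on the last two factors. -/
def R23 (ℛ : G × G → G × G) : G × G × G → G × G × G :=
  fun p => (p.1, (ℛ (p.2.1, p.2.2)).1, (ℛ (p.2.1, p.2.2)).2)

/-- `ℛ₁₃ : G × G × G → G × G × G`, acting by `ℛ` on the outer two factors. -/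
def R13 (ℛ : G × G → G × G) : G × G × G → G × G × G :=
  fun p => ((ℛ (p.1, p.2.2)).1, p.2.1, (ℛ (p.1, p.2.2)).2)

/-- If `ℛ : G × G → G × G` satisfies `m ∘ ℛ = m ∘ flip` and the two
set-theoretic hexagon identities, then `ℛ` satisfies the set-theoretic quantum
Yang–Baxter equation `ℛ₁₂ ∘ ℛ₁₃ ∘ ℛ₂₃ = ℛ₂₃ ∘ ℛ₁₃ ∘ ℛ₁₂` on `G × G × G`. -/
theorem set_theoretic_qybe (ℛ : G × G → G × G)
    (h1 : ∀ u v : G, (ℛ (u, v)).1 * (ℛ (u, v)).2 = v * u)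
    (h2 : ∀ u v w : G,
      ℛ (u * v, w)
        = ((ℛ (u, w)).1 * (ℛ (v, (ℛ (u, w)).2)).1, (ℛ (v, (ℛ (u, w)).2)).2))
    (h3 : ∀ u v w : G,
      ℛ (u, v * w)
        = ((ℛ ((ℛ (u, w)).1, v)).1, (ℛ ((ℛ (u, w)).1, v)).2 * (ℛ (u, w)).2)) :
    R12 ℛ ∘ R13 ℛ ∘ R23 ℛ = R23 ℛ ∘ R13 ℛ ∘ R12 ℛ := by
  funext ⟨a, b, c⟩
  have hcb := h3 a (ℛ (b, c)).1 (ℛ (b, c)).2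
  rw [h1, h3] at hcb
  have hba := h2 (ℛ (a, b)).1 (ℛ (a, b)).2 c
  rw [h1, h2] at hba
  simp only [Prod.mk.injEq] at hcb hba
  obtain ⟨hfst, -⟩ := hcb
  obtain ⟨-, hthd⟩ := hba
  -- Both sides have total product `c * b * a`, so the middle components agree as well.
  have hl : (ℛ ((ℛ (a, (ℛ (b, c)).2)).1, (ℛ (b, c)).1)).1 *
      (ℛ ((ℛ (a, (ℛ (b, c)).2)).1, (ℛ (b, c)).1)).2 * (ℛ (a, (ℛ (b, c)).2)).2 = c * b * a := by
    rw [h1, mul_assoc, h1, ← mul_assoc, h1]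
  have hr : (ℛ ((ℛ (a, b)).1, c)).1 *
      (ℛ ((ℛ (a, b)).2, (ℛ ((ℛ (a, b)).1, c)).2)).1 *
      (ℛ ((ℛ (a, b)).2, (ℛ ((ℛ (a, b)).1, c)).2)).2 = c * b * a := by
    rw [mul_assoc, h1, ← mul_assoc, h1, mul_assoc, h1, mul_assoc]
  rw [← hfst, hthd, ← hr] at hl
  have hsnd := mul_left_cancel (mul_right_cancel hl)
  simp only [Function.comp_apply, R12, R13, R23, Prod.mk.injEq]
  exact ⟨hfst.symm, hsnd, hthd⟩
end

section
/- Let M = [[a, b],[c, d]] ∈ SL₂(ℂ) with d ≠ 0. Then the fiber J⁻¹(M) consists of exactly the pairs (L(−z·c, z), U(z·b, z)) where z ranges over the two complex numbers with z² = d⁻¹; in particular J⁻¹(M) has exactly two elements, and they are obtained from one another by negating both matrix components. Hence J is a surjective two-to-one map from G* onto the big cell G⁰. -/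
open Matrix

/-- `SL₂(ℂ)`, the group of 2×2 complex matrices of determinant 1. -/
abbrev SL2 := Matrix.SpecialLinearGroup (Fin 2) ℂ

/-- The lower triangular matrix `L(y,z) = [[z⁻¹, 0],[y, z]]` as an element of `SL₂(ℂ)`. -/
noncomputable def L (y z : ℂ) (hz : z ≠ 0) : SL2 :=
  ⟨!![z⁻¹, 0; y, z], by simp [Matrix.det_fin_two_of, inv_mul_cancel₀ hz]⟩

/-- The upper triangular matrix `U(x,z) = [[z, x],[0, z⁻¹]]` as an element of `SL₂(ℂ)`. -/
noncomputable def U (x z : ℂ) (hz : z ≠ 0) : SL2 :=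
  ⟨!![z, x; 0, z⁻¹], by simp [Matrix.det_fin_two_of, mul_inv_cancel₀ hz]⟩

/-- The dual group `G* = {(L(y,z), U(x,z)) : x, y ∈ ℂ, z ∈ ℂ, z ≠ 0} ⊆ SL₂(ℂ) × SL₂(ℂ)`. -/
def Gstar : Set (SL2 × SL2) :=
  {p | ∃ (x y z : ℂ) (hz : z ≠ 0), p = (L y z hz, U x z hz)}

/-- The matrix `−I` as an element of `SL₂(ℂ)`. -/
noncomputable def negI : SL2 := ⟨-1, by simp [Matrix.det_neg]⟩

/-- The map `J : G* → SL₂(ℂ)`, `J(A,B) = B · A⁻¹` (defined on all of `SL₂ × SL₂`). -/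
noncomputable def J (p : SL2 × SL2) : SL2 := p.2 * p.1⁻¹

theorem coe_J_L_U (x y z : ℂ) (hz : z ≠ 0) :
    (J (L y z hz, U x z hz) : Matrix (Fin 2) (Fin 2) ℂ)
      = !![z ^ 2 - x * y, x * z⁻¹; -(z⁻¹ * y), (z ^ 2)⁻¹] := by
  rw [_root_.J, Matrix.SpecialLinearGroup.coe_mul, Matrix.SpecialLinearGroup.coe_inv]
  simp only [L, U, adjugate_fin_two_of]
  ext i j
  fin_cases i <;> fin_cases j <;> simp [Matrix.mul_apply, Fin.sum_univ_two] <;> ring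

theorem J_L_U_eq_iff (x y z : ℂ) (hz : z ≠ 0) (M : SL2) :
    J (L y z hz, U x z hz) = M ↔ z ^ 2 = (M 1 1)⁻¹ ∧ y = -(z * M 1 0) ∧ x = z * M 0 1 := by
  have key : J (L y z hz, U x z hz) = M ↔
      (z ^ 2 - x * y = M 0 0 ∧ x * z⁻¹ = M 0 1) ∧ -(z⁻¹ * y) = M 1 0 ∧ (z ^ 2)⁻¹ = M 1 1 := by
    refine Subtype.ext_iff.trans ?_
    rw [coe_J_L_U]
    simp [← Matrix.ext_iff, Fin.forall_fin_two]
  have hdet : M 0 0 * M 1 1 - M 0 1 * M 1 0 = 1 := by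
    rw [← Matrix.det_fin_two]
    exact M.det_coe
  rw [key]
  constructor
  · rintro ⟨⟨-, h01⟩, h10, h11⟩
    rw [← h01, ← h10, ← h11]
    refine ⟨by simp, ?_, ?_⟩ <;> field_simp
  · rintro ⟨h, rfl, rfl⟩
    have hd : M 1 1 ≠ 0 := by
      intro h0
      simp [h0, hz] at h
    have hzd : z ^ 2 * M 1 1 = 1 := by rw [h, inv_mul_cancel₀ hd]
    refine ⟨⟨?_, by field_simp⟩, by field_simp, by rw [h, inv_inv]⟩
    linear_combination (-z ^ 2) * hdet + M 0 0 * hzd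

theorem J_fiber_eq (M : SL2) :
    {p | p ∈ Gstar ∧ J p = M} = {p | ∃ (z : ℂ) (hz : z ≠ 0), z ^ 2 = (M 1 1)⁻¹ ∧
      p = (L (-(z * M 1 0)) z hz, U (z * M 0 1) z hz)} := by
  ext p
  constructor
  · rintro ⟨⟨x, y, z, hz, rfl⟩, h⟩
    obtain ⟨hsq, rfl, rfl⟩ := (J_L_U_eq_iff x y z hz M).1 h
    exact ⟨z, hz, hsq, rfl⟩
  · rintro ⟨z, hz, h, rfl⟩
    exact ⟨⟨_, _, z, hz, rfl⟩, (J_L_U_eq_iff _ _ z hz M).2 ⟨h, rfl, rfl⟩⟩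

theorem L_neg (y z : ℂ) (hz : z ≠ 0) : L (-y) (-z) (neg_ne_zero.2 hz) = negI * L y z hz := by
  refine Subtype.ext (Eq.trans ?_ (Matrix.SpecialLinearGroup.coe_mul _ _).symm)
  simp [L, negI, inv_neg]

theorem U_neg (x z : ℂ) (hz : z ≠ 0) : U (-x) (-z) (neg_ne_zero.2 hz) = negI * U x z hz := by
  refine Subtype.ext (Eq.trans ?_ (Matrix.SpecialLinearGroup.coe_mul _ _).symm)
  simp [U, negI, inv_neg]

theorem eq_of_U_eq_U {x x' z z' : ℂ} (hz : z ≠ 0) (hz' : z' ≠ 0)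
    (h : U x z hz = U x' z' hz') :
    z = z' := by
  simpa [U] using congrArg (fun A : SL2 => A 0 0) h

theorem eq_negI_mul_of_mem_J_fiber {M : SL2} {p q : SL2 × SL2}
    (hp : p ∈ Gstar ∧ J p = M) (hq : q ∈ Gstar ∧ J q = M) (hpq : p ≠ q) :
    q = (negI * p.1, negI * p.2) := by
  obtain ⟨z, hz, h, rfl⟩ := (J_fiber_eq M).subset hp
  obtain ⟨w, hw, h', rfl⟩ := (J_fiber_eq M).subset hq
  rcases sq_eq_sq_iff_eq_or_eq_neg.1 (h'.trans h.symm) with rfl | rfl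
  · exact absurd rfl hpq
  · simp only [neg_mul, L_neg _ z hz, U_neg _ z hz]

theorem ncard_J_fiber (M : SL2) (hM : M 1 1 ≠ 0) : {p | p ∈ Gstar ∧ J p = M}.ncard = 2 := by
  obtain ⟨z, h⟩ := IsAlgClosed.exists_pow_nat_eq (M 1 1)⁻¹ two_pos
  have hz : z ≠ 0 := by
    rintro rfl
    exact inv_ne_zero hM (by simpa using h.symm)
  rw [J_fiber_eq, Set.ncard_eq_two]
  refine ⟨(L (-(z * M 1 0)) z hz, U (z * M 0 1) z hz),
    (L (-(-z * M 1 0)) (-z) (neg_ne_zero.2 hz), U (-z * M 0 1) (-z) (neg_ne_zero.2 hz)), ?_, ?_⟩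
  · intro heq
    exact hz (self_eq_neg.1 (eq_of_U_eq_U hz (neg_ne_zero.2 hz) (congrArg Prod.snd heq)))
  · ext p
    constructor
    · rintro ⟨w, hw, h', rfl⟩
      rcases sq_eq_sq_iff_eq_or_eq_neg.1 (h'.trans h.symm) with rfl | rfl
      · exact Or.inl rfl
      · exact Or.inr rfl
    · rintro (rfl | rfl)
      · exact ⟨z, hz, h, rfl⟩
      · exact ⟨-z, neg_ne_zero.2 hz, by rw [neg_sq, h], rfl⟩

/-- For `M = [[a,b],[c,d]] ∈ SL₂(ℂ)` with `d ≠ 0`, the fiber `J⁻¹(M)`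
consists exactly of the pairs `(L(−z·c, z), U(z·b, z))` with `z² = d⁻¹`; it has exactly
two elements, obtained from one another by negating both matrix components.  Hence `J` is
a surjective two-to-one map from `G*` onto the big cell `G⁰`. -/
theorem J_fiber (a b c d : ℂ) (hd : d ≠ 0) (M : SL2)
    (hM : (M : Matrix (Fin 2) (Fin 2) ℂ) = !![a, b; c, d]) :
    ({p | p ∈ Gstar ∧ J p = M}
      = {p | ∃ (z : ℂ) (hz : z ≠ 0), z ^ 2 = d⁻¹ ∧ p = (L (-(z * c)) z hz, U (z * b) z hz)}) ∧
    {p | p ∈ Gstar ∧ J p = M}.ncard = 2 ∧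
    (∀ p ∈ {p : SL2 × SL2 | p ∈ Gstar ∧ J p = M},
      ∀ q ∈ {p : SL2 × SL2 | p ∈ Gstar ∧ J p = M},
        p ≠ q → q = (negI * p.1, negI * p.2)) ∧
    (∀ N : SL2, (N : Matrix (Fin 2) (Fin 2) ℂ) 1 1 ≠ 0 →
      {p | p ∈ Gstar ∧ J p = N}.ncard = 2) := by
  have h01 : M 0 1 = b := congrFun (congrFun hM 0) 1
  have h10 : M 1 0 = c := congrFun (congrFun hM 1) 0
  have h11 : M 1 1 = d := congrFun (congrFun hM 1) 1
  refine ⟨?_, ncard_J_fiber M (h11 ▸ hd),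
    fun p hp q hq => eq_negI_mul_of_mem_J_fiber hp hq, ncard_J_fiber⟩
  rw [J_fiber_eq, h01, h10, h11]
end

section
/- Let x, y, η ∈ ℂ, let z, ζ ∈ ℂ be nonzero, and let Θ ∈ ℂ be nonzero with Θ² = 1 + η·x·z·ζ⁻¹. Set X := [[z² − x·y, z⁻¹·x],[−z⁻¹·y, z⁻²]], N := L(η,ζ), W₊ := [[z·Θ⁻¹, x·ζ⁻²·Θ⁻¹],[0, z⁻¹·Θ]] and W₋ := [[z⁻¹·Θ, 0],[y·ζ²·Θ + η·ζ·(z⁻¹·Θ − z³·Θ⁻¹), z·Θ⁻¹]]. Then W₊ and W₋ have determinant 1, i.e. lie in SL₂(ℂ), and N · X · N⁻¹ = W₊ · W₋⁻¹ (the Gauss factorization of the conjugate N · X · N⁻¹ into an upper and a lower triangular factor). -/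
open Matrix

/-- The lower triangular matrix `L(y,z) = [[z⁻¹, 0],[y, z]]`. -/
noncomputable def Lm (y z : ℂ) : Matrix (Fin 2) (Fin 2) ℂ := !![z⁻¹, 0; y, z]

/-- The upper triangular matrix `U(x,z) = [[z, x],[0, z⁻¹]]`. -/
noncomputable def Um (x z : ℂ) : Matrix (Fin 2) (Fin 2) ℂ := !![z, x; 0, z⁻¹]

/-- The matrix `X = [[z² − x·y, z⁻¹·x],[−z⁻¹·y, z⁻²]] = J(L(y,z), U(x,z))`. -/
noncomputable def Xm (x y z : ℂ) : Matrix (Fin 2) (Fin 2) ℂ :=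
  !![z ^ 2 - x * y, z⁻¹ * x; -(z⁻¹ * y), (z ^ 2)⁻¹]

/-- The upper triangular factor `W₊ = [[z·Θ⁻¹, x·ζ⁻²·Θ⁻¹],[0, z⁻¹·Θ]]`. -/
noncomputable def Wp (x z ζ Θ : ℂ) : Matrix (Fin 2) (Fin 2) ℂ :=
  !![z * Θ⁻¹, x * (ζ ^ 2)⁻¹ * Θ⁻¹; 0, z⁻¹ * Θ]

/-- The lower triangular factor
`W₋ = [[z⁻¹·Θ, 0],[y·ζ²·Θ + η·ζ·(z⁻¹·Θ − z³·Θ⁻¹), z·Θ⁻¹]]`. -/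
noncomputable def Wm (y η z ζ Θ : ℂ) : Matrix (Fin 2) (Fin 2) ℂ :=
  !![z⁻¹ * Θ, 0; y * ζ ^ 2 * Θ + η * ζ * (z⁻¹ * Θ - z ^ 3 * Θ⁻¹), z * Θ⁻¹]

/-- With `Θ² = 1 + η·x·z·ζ⁻¹`, `Θ ≠ 0`, the matrices `W₊` and `W₋`
lie in `SL₂(ℂ)` and give the Gauss factorization `N · X · N⁻¹ = W₊ · W₋⁻¹` of the
conjugate of `X` by `N = L(η,ζ)`. -/
theorem gauss_factorization_first (x y η : ℂ) (z ζ : ℂ) (hz : z ≠ 0) (hζ : ζ ≠ 0)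
    (Θ : ℂ) (hΘ : Θ ≠ 0) (hΘ2 : Θ ^ 2 = 1 + η * x * z * ζ⁻¹) :
    (Wp x z ζ Θ).det = 1 ∧
    (Wm y η z ζ Θ).det = 1 ∧
    Lm η ζ * Xm x y z * (Lm η ζ)⁻¹ = Wp x z ζ Θ * (Wm y η z ζ Θ)⁻¹ := by
  have hWp : (Wp x z ζ Θ).det = 1 := by
    simp only [Wp, det_fin_two_of]
    field_simp
    ring
  have hWm : (Wm y η z ζ Θ).det = 1 := by
    simp only [Wm, det_fin_two_of]
    field_simp
    ring
  have hL : (Lm η ζ).det = 1 := by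
    simp [Lm, det_fin_two_of, hζ]
  refine ⟨hWp, hWm, ?_⟩
  have hΘζ : Θ ^ 2 * ζ = ζ + η * x * z := by
    rw [hΘ2]
    field_simp
  rw [inv_def, inv_def, hL, hWm, Ring.inverse_one, one_smul, one_smul]
  simp only [Lm, Xm, Wp, Wm, adjugate_fin_two_of, mul_fin_two]
  ext i j
  fin_cases i <;> fin_cases j <;> simp <;> field_simp
  · linear_combination z ^ 3 * hΘζ
  · linear_combination (η + z * ζ * y) * hΘζ
  · linear_combination -hΘζ
end

section
/- Let x, η, χ ∈ ℂ and let z, ζ, Θ ∈ ℂ be nonzero with Θ² = 1 + η·x·z·ζ⁻¹. Set Y := [[ζ² − χ·η, ζ⁻¹·χ],[−ζ⁻¹·η, ζ⁻²]] (which equals J(L(η,ζ), U(χ,ζ)) and lies in SL₂(ℂ)), W₊ := [[z·Θ⁻¹, x·ζ⁻²·Θ⁻¹],[0, z⁻¹·Θ]], U₊ := [[ζ·Θ, χ·z⁻²·Θ + x·z⁻¹·ζ·Θ − x·z⁻¹·ζ⁻³·Θ⁻¹],[0, ζ⁻¹·Θ⁻¹]] and U₋ := [[ζ⁻¹·Θ⁻¹,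 0],[η·z²·Θ⁻¹, ζ·Θ]]. Then U₊ and U₋ have determinant 1, i.e. lie in SL₂(ℂ), and W₊⁻¹ · Y · W₊ = U₊ · U₋⁻¹ (the Gauss factorization of the conjugate W₊⁻¹ · Y · W₊ into an upper and a lower triangular factor). -/
open Matrix

/-- The matrix `Y = [[ζ² − χ·η, ζ⁻¹·χ],[−ζ⁻¹·η, ζ⁻²]] = J(L(η,ζ), U(χ,ζ))`. -/
noncomputable def Ym (χ η ζ : ℂ) : Matrix (Fin 2) (Fin 2) ℂ :=
  !![ζ ^ 2 - χ * η, ζ⁻¹ * χ; -(ζ⁻¹ * η), (ζ ^ 2)⁻¹]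

/-- The upper triangular factor
`U₊ = [[ζ·Θ, χ·z⁻²·Θ + x·z⁻¹·ζ·Θ − x·z⁻¹·ζ⁻³·Θ⁻¹],[0, ζ⁻¹·Θ⁻¹]]`. -/
noncomputable def Up (x χ z ζ Θ : ℂ) : Matrix (Fin 2) (Fin 2) ℂ :=
  !![ζ * Θ, χ * (z ^ 2)⁻¹ * Θ + x * z⁻¹ * ζ * Θ - x * z⁻¹ * (ζ ^ 3)⁻¹ * Θ⁻¹;
     0, ζ⁻¹ * Θ⁻¹]

/-- The lower triangular factor `U₋ = [[ζ⁻¹·Θ⁻¹, 0],[η·z²·Θ⁻¹, ζ·Θ]]`. -/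
noncomputable def Un (η z ζ Θ : ℂ) : Matrix (Fin 2) (Fin 2) ℂ :=
  !![ζ⁻¹ * Θ⁻¹, 0; η * z ^ 2 * Θ⁻¹, ζ * Θ]

theorem Lm_det (y : ℂ) {z : ℂ} (hz : z ≠ 0) : (Lm y z).det = 1 := by
  simp [Lm, det_fin_two, hz]

theorem Ym_det (χ η : ℂ) {ζ : ℂ} (hζ : ζ ≠ 0) : (Ym χ η ζ).det = 1 := by
  simp only [Ym, det_fin_two_of]
  field_simp
  ring

theorem Wp_det (x : ℂ) {z ζ Θ : ℂ} (hz : z ≠ 0) (hΘ : Θ ≠ 0) :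
    (Wp x z ζ Θ).det = 1 := by
  simp only [Wp, det_fin_two_of]
  field_simp
  ring

theorem Up_det (x χ z : ℂ) {ζ Θ : ℂ} (hζ : ζ ≠ 0) (hΘ : Θ ≠ 0) :
    (Up x χ z ζ Θ).det = 1 := by
  simp only [Up, det_fin_two_of]
  field_simp
  ring

theorem Un_det (η z : ℂ) {ζ Θ : ℂ} (hζ : ζ ≠ 0) (hΘ : Θ ≠ 0) :
    (Un η z ζ Θ).det = 1 := by
  simp only [Un, det_fin_two_of]
  field_simp
  ring

theorem Ym_mul_Lm (χ η : ℂ) {ζ : ℂ} (hζ : ζ ≠ 0) : Ym χ η ζ * Lm η ζ = Um χ ζ := by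
  ext i j
  fin_cases i <;> fin_cases j <;> simp [Ym, Lm, Um] <;> field_simp <;> ring

/-- The Gauss factorization with all inverses cleared. -/
theorem Ym_mul_Wp_mul_Un (x η χ : ℂ) {z ζ Θ : ℂ}
    (hz : z ≠ 0) (hζ : ζ ≠ 0) (hΘ : Θ ≠ 0) (hΘ2 : Θ ^ 2 = 1 + η * x * z * ζ⁻¹) :
    Ym χ η ζ * Wp x z ζ Θ * Un η z ζ Θ = Wp x z ζ Θ * Up x χ z ζ Θ := by
  ext i j
  fin_cases i <;> fin_cases j <;> simp [Ym, Wp, Un, Up] <;> field_simp at hΘ2 ⊢ <;> grind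

/-- With `Θ² = 1 + η·x·z·ζ⁻¹` and `z, ζ, Θ ≠ 0`, the matrices `U₊`
and `U₋` lie in `SL₂(ℂ)` and give the Gauss factorization
`W₊⁻¹ · Y · W₊ = U₊ · U₋⁻¹`, where `Y = J(L(η,ζ), U(χ,ζ))`. -/
theorem gauss_factorization_second (x η χ : ℂ) (z ζ Θ : ℂ)
    (hz : z ≠ 0) (hζ : ζ ≠ 0) (hΘ : Θ ≠ 0) (hΘ2 : Θ ^ 2 = 1 + η * x * z * ζ⁻¹) :
    Ym χ η ζ = Um χ ζ * (Lm η ζ)⁻¹ ∧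
    (Ym χ η ζ).det = 1 ∧
    (Up x χ z ζ Θ).det = 1 ∧
    (Un η z ζ Θ).det = 1 ∧
    (Wp x z ζ Θ)⁻¹ * Ym χ η ζ * Wp x z ζ Θ = Up x χ z ζ Θ * (Un η z ζ Θ)⁻¹ := by
  have hL : IsUnit (Lm η ζ).det := by simp [Lm_det η hζ]
  have hW : IsUnit (Wp x z ζ Θ).det := by simp [Wp_det x hz hΘ]
  have hU : IsUnit (Un η z ζ Θ).det := by simp [Un_det η z hζ hΘ]
  refine ⟨?_, Ym_det χ η hζ, Up_det x χ z hζ hΘ, Un_det η z hζ hΘ, ?_⟩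
  · rw [← Ym_mul_Lm χ η hζ, mul_nonsing_inv_cancel_right _ _ hL]
  · rw [← nonsing_inv_mul_cancel_left _ (Up x χ z ζ Θ) hW,
      ← Ym_mul_Wp_mul_Un x η χ hz hζ hΘ hΘ2, ← Matrix.mul_assoc,
      mul_nonsing_inv_cancel_right _ _ hU, Matrix.mul_assoc]
end
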